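/- Let 𝔤 be a finite-dimensional real Lie algebra equipped with subspaces 𝔤_p (p ∈ ℤ) such that 𝔤 is the direct sum of the 𝔤_p, ⁅𝔤_p, 𝔤_q⁆ ⊆ 𝔤_{p+q} for all p, q, and 𝔤_p = 0 for all p < −2. Assume: (a) there is a characteristic element E ∈ 𝔤₀, i.e., ⁅E, x⁆ = p·x for all x ∈ 𝔤_p and all p; (b) transitivity: for every p ≥ 0 and x ∈ 𝔤_p, if ⁅x, 𝔤₋₁⁆ = 0 then x = 0; (c) non-degeneracy: for x ∈ 𝔤₋₁, if ⁅x, 𝔤₋₁⁆ = 0 then x = 0; (d) for every p ≥ 1 and x ∈ 𝔤_p, if ⁅x, 𝔤₋₂⁆ = 0 then x = 0; (e) 𝔤₋₂ ≠ 0 and 𝔤₋₂ is irreducible as a 𝔤₀-module, i.e., the only subspaces of 𝔤₋₂ invariant under ⁅𝔤₀, ·⁆ are 0 and 𝔤₋₂; (f) 𝔤₂ ≠ 0. Then 𝔤 is a semisimple Lie algebra. -/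

import Mathlib

namespace St17

variable {L : Type*} [LieRing L] [LieAlgebra ℝ L]

/-- lower filtration -/
def U (g : ℤ → Submodule ℝ L) (m : ℤ) : Submodule ℝ L := ⨆ p : {p : ℤ // p < m}, g p

lemma U_succ (g : ℤ → Submodule ℝ L) (m : ℤ) : U g (m + 1) ≤ g m ⊔ U g m := by
  refine iSup_le ?_
  rintro ⟨p, hp⟩
  by_cases h : p = m
  · subst h; exact le_sup_left
  · exact le_sup_of_le_right (le_iSup (fun p : {p : ℤ // p < m} => g p) ⟨p, by lia⟩)

lemma U_mono (g : ℤ → Submodule ℝ L) {m n : ℤ} (h : m ≤ n) : U g m ≤ U g n := by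
  refine iSup_le ?_
  rintro ⟨p, hp⟩
  exact (le_iSup (fun p : {p : ℤ // p < n} => g p) ⟨p, by lia⟩)

lemma le_U (g : ℤ → Submodule ℝ L) {p m : ℤ} (h : p < m) : g p ≤ U g m :=
  le_iSup (fun p : {p : ℤ // p < m} => g p) ⟨p, h⟩

lemma U_lie (g : ℤ → Submodule ℝ L)
    (hbr : ∀ p q : ℤ, ∀ x ∈ g p, ∀ y ∈ g q, ⁅x, y⁆ ∈ g (p + q)) (m : ℤ) (w y : L)
    (hw : w ∈ U g m) (hy : y ∈ g (-1)) : ⁅w, y⁆ ∈ U g (m - 1) := by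
  unfold U at hw
  induction hw using Submodule.iSup_induction' with
  | mem p x hx => exact le_U g (by have := p.2; lia) (hbr _ _ x hx y hy)
  | zero => simp
  | add a b _ _ ha hb => rw [add_lie]; exact add_mem ha hb

lemma U_disj (g : ℤ → Submodule ℝ L) (hdir : DirectSum.IsInternal g) (m : ℤ) (u w : L)
    (hu : u ∈ g m) (hw : w ∈ U g m) (h : u + w = 0) : u = 0 := by
  have h1 := hdir.submodule_iSupIndep m
  refine (Submodule.disjoint_def.mp h1) u hu ?_
  have h2 : U g m ≤ ⨆ j, ⨆ (_ : j ≠ m), g j := by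
    refine iSup_le ?_
    rintro ⟨p, hp⟩
    exact le_iSup₂_of_le p (by lia) le_rfl
  rw [eq_neg_of_add_eq_zero_left h]
  exact neg_mem (h2 hw)

lemma exists_U (g : ℤ → Submodule ℝ L) (hdir : DirectSum.IsInternal g) (v : L) :
    ∃ n : ℕ, v ∈ U g ((n : ℤ) - 2) := by
  have hv : v ∈ ⨆ p, g p := by rw [hdir.submodule_iSup_eq_top]; trivial
  induction hv using Submodule.iSup_induction' with
  | mem p x hx => exact ⟨(p + 3).toNat, le_U g (by lia) hx⟩
  | zero => exact ⟨0, zero_mem _⟩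
  | add a b _ _ ha hb =>
    obtain ⟨n, hn⟩ := ha
    obtain ⟨k, hk⟩ := hb
    exact ⟨max n k, add_mem (U_mono g (by lia) hn) (U_mono g (by lia) hk)⟩

lemma descend (g : ℤ → Submodule ℝ L) (hdir : DirectSum.IsInternal g)
    (hbr : ∀ p q : ℤ, ∀ x ∈ g p, ∀ y ∈ g q, ⁅x, y⁆ ∈ g (p + q))
    (hlow : ∀ p : ℤ, p < -2 → g p = ⊥)
    (htr : ∀ p : ℤ, -1 ≤ p → ∀ x ∈ g p, (∀ y ∈ g (-1), ⁅x, y⁆ = 0) → x = 0)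
    (I : LieIdeal ℝ L) (n : ℕ) :
    ∀ v ∈ I, v ∈ U g ((n : ℤ) - 2) → v ≠ 0 → ∃ z ∈ I, z ∈ g (-2) ∧ z ≠ 0 := by
  have hbot : U g (-2) = ⊥ := by
    refine iSup_eq_bot.mpr ?_
    rintro ⟨p, hp⟩
    exact hlow p hp
  induction n with
  | zero =>
    intro v _ hv h0
    have hv' : v ∈ U g (-2) := by simpa using hv
    rw [hbot] at hv'
    exact absurd ((Submodule.mem_bot ℝ).mp hv') h0
  | succ n ih =>
    intro v hI hv h0
    have hv' : v ∈ g ((n : ℤ) - 2) ⊔ U g ((n : ℤ) - 2) :=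
      U_succ g _ (by convert hv using 2; push_cast; ring)
    obtain ⟨u, hu, w, hw, rfl⟩ := Submodule.mem_sup.mp hv'
    by_cases hu0 : u = 0
    · subst hu0
      exact ih _ hI (by simpa using hw) h0
    rcases Nat.eq_zero_or_pos n with rfl | hn
    · have hw' : w ∈ U g (-2) := by simpa using hw
      rw [hbot] at hw'
      have hw0 := (Submodule.mem_bot ℝ).mp hw'
      subst hw0
      exact ⟨_, hI, by simpa using hu, h0⟩
    · obtain ⟨y, hy, hy0⟩ : ∃ y ∈ g (-1), ⁅u, y⁆ ≠ 0 := by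
        by_contra! hcon
        exact hu0 (htr _ (by lia) u hu hcon)
      have h1 : ⁅u, y⁆ ∈ g ((n : ℤ) - 3) := by
        have := hbr _ _ u hu y hy
        convert this using 2; ring
      have h2 : ⁅w, y⁆ ∈ U g ((n : ℤ) - 3) := by
        have := U_lie g hbr _ w y hw hy
        convert this using 2; ring
      refine ih ⁅u + w, y⁆ (lie_mem_left ℝ L I _ _ hI) ?_ ?_
      · rw [add_lie]
        exact add_mem (le_U g (by lia) h1) (U_mono g (by lia) h2)
      · rw [add_lie]
        intro h
        exact hy0 (U_disj g hdir _ _ _ h1 h2 h)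

/-- the annihilator of the derived algebra of an ideal -/
def annIdeal (N : LieIdeal ℝ L) : LieIdeal ℝ L where
  carrier := {v | ∀ m ∈ N, ∀ n ∈ N, ⁅⁅m, n⁆, v⁆ = 0}
  zero_mem' := by intro m _ n _; simp
  add_mem' := by
    intro a b ha hb m hm n hn
    rw [lie_add, ha m hm n hn, hb m hm n hn, add_zero]
  smul_mem' := by
    intro c a ha m hm n hn
    rw [lie_smul, ha m hm n hn, smul_zero]
  lie_mem := by
    intro l v hv m hm n hn
    have h1 := hv ⁅m, l⁆ (lie_mem_left ℝ L N _ _ hm) n hn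
    have h2 := hv m hm ⁅n, l⁆ (lie_mem_left ℝ L N _ _ hn)
    have h3 := hv m hm n hn
    rw [leibniz_lie ⁅m, n⁆ l v, h3, lie_zero, add_zero]
    have h4 : ⁅⁅m, n⁆, l⁆ = ⁅⁅m, l⁆, n⁆ + ⁅m, ⁅n, l⁆⁆ := by
      rw [leibniz_lie m n l, ← lie_skew ⁅m, l⁆ n, lie_lie]; abel
    rw [h4, add_lie, h1, h2, add_zero]

lemma exists_ann [FiniteDimensional ℝ L] [Nontrivial L] :
    ∃ v ∈ annIdeal (LieIdeal.killingCompl ℝ L ⊤), v ≠ 0 := by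
  set N := LieIdeal.killingCompl ℝ L ⊤ with hN
  have tf : LieModule.traceForm ℝ N L = 0 := by
    ext ⟨x, hx⟩ ⟨y, hy⟩
    change killingForm ℝ L x y = 0
    exact (LieIdeal.mem_killingCompl ℝ L ⊤).mp hy x trivial
  have hnil := LieModule.isNilpotent_derivedSeries_of_traceForm_eq_zero tf
  have hnt := LieModule.nontrivial_max_triv_of_isNilpotent ℝ
    (LieAlgebra.derivedSeries ℝ N 1) L
  obtain ⟨⟨v, hv⟩, hv0⟩ := exists_ne (0 : LieModule.maxTrivSubmodule ℝ (LieAlgebra.derivedSeries ℝ N 1) L)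
  refine ⟨v, ?_, fun h => hv0 (Subtype.ext h)⟩
  intro m hm n hn
  have hmem : ⁅(⟨m, hm⟩ : N), (⟨n, hn⟩ : N)⁆ ∈ LieAlgebra.derivedSeries ℝ N 1 := by
    simpa using LieSubmodule.lie_mem_lie (LieSubmodule.mem_top (R := ℝ) (L := N) (⟨m, hm⟩ : N)) (LieSubmodule.mem_top (R := ℝ) (L := N) (⟨n, hn⟩ : N))
  rw [LieModule.mem_maxTrivSubmodule] at hv
  exact hv ⟨_, hmem⟩

lemma expand2 (x y z : L) :
    ⁅⁅⁅x, y⁆, y⁆, z⁆ = ⁅x, ⁅y, ⁅y, z⁆⁆⁆ - (2:ℝ) • ⁅y, ⁅x, ⁅y, z⁆⁆⁆ + ⁅y, ⁅y, ⁅x, z⁆⁆⁆ := by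
  rw [lie_lie ⁅x, y⁆ y z, lie_lie x y ⁅y, z⁆, lie_lie x y z, lie_sub]
  module

lemma expand4 (x y w : L) :
    ⁅⁅⁅⁅⁅x, y⁆, y⁆, y⁆, y⁆, w⁆ = ⁅x, ⁅y, ⁅y, ⁅y, ⁅y, w⁆⁆⁆⁆⁆ - (4:ℝ) • ⁅y, ⁅x, ⁅y, ⁅y, ⁅y, w⁆⁆⁆⁆⁆
      + (6:ℝ) • ⁅y, ⁅y, ⁅x, ⁅y, ⁅y, w⁆⁆⁆⁆⁆ - (4:ℝ) • ⁅y, ⁅y, ⁅y, ⁅x, ⁅y, w⁆⁆⁆⁆⁆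
      + ⁅y, ⁅y, ⁅y, ⁅y, ⁅x, w⁆⁆⁆⁆⁆ := by
  rw [expand2 ⁅⁅x, y⁆, y⁆ y w, expand2 x y ⁅y, ⁅y, w⁆⁆, expand2 x y ⁅y, w⁆, expand2 x y w]
  simp only [lie_sub, lie_add, lie_smul]
  module

/-- the operator `z ↦ [y,[y,[x,z]]]` -/
noncomputable def T (x y : L) : L →ₗ[ℝ] L :=
  (LieAlgebra.ad ℝ L y : L →ₗ[ℝ] L) ∘ₗ (LieAlgebra.ad ℝ L y : L →ₗ[ℝ] L) ∘ₗ
    (LieAlgebra.ad ℝ L x : L →ₗ[ℝ] L)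

lemma T_apply (x y z : L) : T x y z = ⁅y, ⁅y, ⁅x, z⁆⁆⁆ := rfl

/-- commuting square-zero operators have a common kernel -/
lemma common_ker [FiniteDimensional ℝ L] (A : Submodule ℝ L) (hA : A ≠ ⊥)
    (S : Set (L →ₗ[ℝ] L)) (hS : ∀ t ∈ S, ∀ z ∈ A, t z ∈ A)
    (hc : ∀ t ∈ S, ∀ s ∈ S, ∀ z ∈ A, t (s z) = s (t z))
    (hsq : ∀ t ∈ S, ∀ z ∈ A, t (t z) = 0) :
    ∃ v ∈ A, v ≠ 0 ∧ ∀ t ∈ S, t v = 0 := by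
  let P : Set (Submodule ℝ L) := {W | W ≠ ⊥ ∧ W ≤ A ∧ ∀ t ∈ S, ∀ z ∈ W, t z ∈ W}
  have hP : P.Nonempty := ⟨A, hA, le_rfl, hS⟩
  obtain ⟨W, ⟨hW0, hWA, hWS⟩, hmin⟩ :=
    WellFounded.has_min (wellFounded_lt (α := Submodule ℝ L)) P hP
  obtain ⟨v, hv, hv0⟩ := Submodule.exists_mem_ne_zero_of_ne_bot hW0
  refine ⟨v, hWA hv, hv0, ?_⟩
  intro t ht
  have hle : W.map t ≤ W := by
    rintro _ ⟨z, hz, rfl⟩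
    exact hWS t ht z hz
  by_contra htv
  have hin : W.map t ∈ P := by
    refine ⟨?_, hle.trans hWA, ?_⟩
    · intro h
      exact htv ((Submodule.mem_bot ℝ).mp (h ▸ Submodule.mem_map_of_mem hv))
    · rintro s hs _ ⟨z, hz, rfl⟩
      exact ⟨s z, hWS s hs z hz, hc t ht s hs z (hWA hz)⟩
  have heq : W.map t = W := by
    by_contra hne
    exact hmin _ hin (lt_of_le_of_ne hle hne)
  rw [← heq] at hv
  obtain ⟨z, hz, rfl⟩ := hv
  exact htv (hsq t ht z (hWA hz))

end St17

open St17 in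
/-- Theorem 5.2: a ℤ-graded finite-dimensional real Lie algebra,
with depth 2, a characteristic element, transitive, non-degenerate, with the
property (d) of Lemma 5.1, with 𝔤₋₂ a nonzero irreducible 𝔤₀-module and 𝔤₂ ≠ 0,
is semisimple. -/
theorem stmt17
    (L : Type*) [LieRing L] [LieAlgebra ℝ L] [FiniteDimensional ℝ L]
    (g : ℤ → Submodule ℝ L)
    (hdir : DirectSum.IsInternal g)
    (hbr : ∀ p q : ℤ, ∀ x ∈ g p, ∀ y ∈ g q, ⁅x, y⁆ ∈ g (p + q))
    (hlow : ∀ p : ℤ, p < -2 → g p = ⊥)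
    (E : L) (hE : E ∈ g 0)
    (hchar : ∀ p : ℤ, ∀ x ∈ g p, ⁅E, x⁆ = (p : ℝ) • x)
    (htrans : ∀ p : ℤ, 0 ≤ p → ∀ x ∈ g p, (∀ y ∈ g (-1), ⁅x, y⁆ = 0) → x = 0)
    (hnondeg : ∀ x ∈ g (-1), (∀ y ∈ g (-1), ⁅x, y⁆ = 0) → x = 0)
    (hLem51 : ∀ p : ℤ, 1 ≤ p → ∀ x ∈ g p, (∀ y ∈ g (-2), ⁅x, y⁆ = 0) → x = 0)
    (hne : g (-2) ≠ ⊥)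
    (hirr : ∀ W : Submodule ℝ L, W ≤ g (-2) →
      (∀ x ∈ g 0, ∀ w ∈ W, ⁅x, w⁆ ∈ W) → W = ⊥ ∨ W = g (-2))
    (h2ne : g 2 ≠ ⊥) :
    LieAlgebra.IsSemisimple ℝ L := by
  have htr : ∀ p : ℤ, -1 ≤ p → ∀ x ∈ g p, (∀ y ∈ g (-1), ⁅x, y⁆ = 0) → x = 0 := by
    intro p hp x hx h
    rcases eq_or_lt_of_le hp with rfl | hp
    · exact hnondeg x hx h
    · exact htrans p (by lia) x hx h
  -- every nonzero ideal contains `g (-2)`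
  have hideal : ∀ I : LieIdeal ℝ L, ∀ v ∈ I, v ≠ 0 → ∀ z ∈ g (-2), z ∈ I := by
    intro I v hv h0
    obtain ⟨n, hn⟩ := exists_U g hdir v
    obtain ⟨z, hzI, hz, hz0⟩ := descend g hdir hbr hlow htr I n v hv hn h0
    have := hirr (g (-2) ⊓ I.toSubmodule) inf_le_left (by
      rintro x hx w ⟨hw1, hw2⟩
      exact ⟨by simpa using hbr 0 (-2) x hx w hw1, I.lie_mem hw2⟩)
    rcases this with h | h
    · exact absurd ((Submodule.mem_bot ℝ).mp (h ▸ (⟨hz, hzI⟩ : z ∈ g (-2) ⊓ I.toSubmodule))) hz0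
    · intro z hz
      rw [← h] at hz
      exact hz.2
  have hrad : LieAlgebra.HasTrivialRadical ℝ L := by
    rw [LieAlgebra.hasTrivialRadical_iff_no_abelian_ideals]
    intro a hab
    by_contra ha
    obtain ⟨v, hv, hv0⟩ : ∃ v ∈ a, v ≠ 0 := by
      by_contra! h
      exact ha ((LieSubmodule.eq_bot_iff a).mpr h)
    have hnt : Nontrivial L := ⟨v, 0, hv0⟩
    have hAa := hideal a v hv hv0
    have habel : ∀ u ∈ a, ∀ w ∈ a, ⁅u, w⁆ = 0 := by
      intro u hu w hw
      have := hab.trivial (⟨u, hu⟩ : a) ⟨w, hw⟩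
      exact congrArg Subtype.val this
    have hpos : ∀ p : ℤ, 1 ≤ p → ∀ u ∈ g p, u ∈ a → u = 0 := fun p hp u hu hua =>
      hLem51 p hp u hu (fun y hy => habel u hua y (hAa y hy))
    let N := LieIdeal.killingCompl ℝ L ⊤
    have haN : a ≤ N := LieIdeal.le_killingCompl_top_of_isLieAbelian ℝ L a
    obtain ⟨v', hv', hv'0⟩ := exists_ann (L := L)
    have hK := hideal _ v' hv' hv'0
    have hK' : ∀ z ∈ g (-2), ∀ m ∈ N, ∀ n ∈ N, ⁅⁅m, n⁆, z⁆ = 0 := hK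
    have h2N : ∀ x ∈ g 2, x ∈ N := by
      intro x hx
      rw [LieIdeal.mem_killingCompl]
      intro u _
      have hu : u ∈ ⨆ p, g p := by rw [hdir.submodule_iSup_eq_top]; trivial
      induction hu using Submodule.iSup_induction' with
      | mem q u hu =>
        by_cases hq : q = -2
        · subst hq
          have := haN (hAa u hu)
          rw [LieModule.traceForm_comm]
          exact (LieIdeal.mem_killingCompl ℝ L ⊤).mp this x trivial
        · have h1 := LieModule.traceForm_apply_lie_apply' ℝ L L E u x
          rw [hchar 2 x hx, hchar q u hu] at h1
          simp only [map_smul, LinearMap.smul_apply, smul_eq_mul] at h1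
          have h2 : ((q : ℝ) + 2) * LieModule.traceForm ℝ L L u x = 0 := by
            push_cast at h1; linarith
          rcases mul_eq_zero.mp h2 with h | h
          · exfalso; apply hq; have : (q : ℝ) = ((-2 : ℤ) : ℝ) := by push_cast; linarith
            exact_mod_cast this
          · exact h
      | zero => simp
      | add b c _ _ hb hc =>
        rw [map_add, LinearMap.add_apply, hb trivial, hc trivial, add_zero]
    have hm3 : ∀ y ∈ g (-1), ∀ z ∈ g (-2), ⁅y, z⁆ = 0 := by
      intro y hy z hz
      have := hbr _ _ y hy z hz
      rw [hlow _ (by norm_num)] at this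
      exact (Submodule.mem_bot ℝ).mp this
    have hw0 : ∀ x ∈ g 2, ∀ z ∈ g (-2), ⁅x, z⁆ ∈ g 0 ∧ ⁅x, z⁆ ∈ a := fun x hx z hz =>
      ⟨by simpa using hbr _ _ x hx z hz, a.lie_mem (hAa z hz)⟩
    have hTA : ∀ x ∈ g 2, ∀ y ∈ g (-1), ∀ z ∈ g (-2), T x y z ∈ g (-2) := by
      intro x hx y hy z hz
      have := hbr _ _ y hy _ (hbr _ _ y hy _ (hw0 x hx z hz).1)
      rw [T_apply]
      simpa using this
    have hTF : ∀ x ∈ g 2, ∀ y ∈ g (-1), ∀ z ∈ g (-2), T x y z = ⁅⁅⁅x, y⁆, y⁆, z⁆ := by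
      intro x hx y hy z hz
      rw [T_apply, expand2, hm3 y hy z hz]
      simp
    -- square zero
    have hsq : ∀ x ∈ g 2, ∀ y ∈ g (-1), ∀ z ∈ g (-2), T x y (T x y z) = 0 := by
      intro x hx y hy z hz
      obtain ⟨hw, hwa⟩ := hw0 x hx z hz
      rw [T_apply, T_apply]
      set w := ⁅x, z⁆ with hwdef
      have h1 : ⁅y, w⁆ ∈ g (-1) := by simpa using hbr _ _ y hy w hw
      have h2 : ⁅y, ⁅y, w⁆⁆ ∈ g (-2) := by simpa using hbr _ _ y hy _ h1
      have h3 : ⁅y, ⁅y, ⁅y, w⁆⁆⁆ = 0 := hm3 y hy _ h2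
      have h4 : ⁅x, w⁆ = 0 := hpos 2 (by norm_num) _ (by simpa using hbr _ _ x hx w hw)
        (a.lie_mem hwa)
      have h5 : ⁅x, ⁅y, w⁆⁆ = 0 := hpos 1 (by norm_num) _ (by simpa using hbr _ _ x hx _ h1)
        (a.lie_mem (a.lie_mem hwa))
      have h6 : ⁅⁅⁅⁅x, y⁆, y⁆, y⁆, y⁆ ∈ g (-2) := by
        have := hbr _ _ _ (hbr _ _ _ (hbr _ _ _ (hbr _ _ x hx y hy) y hy) y hy) y hy
        have h0 : (2 : ℤ) + -1 + -1 + -1 + -1 = -2 := by lia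
        rw [h0] at this
        exact this
      have h7 := habel _ (hAa _ h6) w hwa
      rw [expand4, h3, h4, h5] at h7
      simpa using h7
    have hFN : ∀ x ∈ g 2, ∀ y : L, ⁅⁅x, y⁆, y⁆ ∈ N := fun x hx y =>
      lie_mem_left ℝ L N _ _ (lie_mem_left ℝ L N _ _ (h2N x hx))
    obtain ⟨v₁, hv₁, hv₁0, hv₁T⟩ := common_ker (g (-2)) hne
      {t | ∃ x ∈ g 2, ∃ y ∈ g (-1), t = T x y}
      (by rintro _ ⟨x, hx, y, hy, rfl⟩ z hz; exact hTA x hx y hy z hz)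
      (by
        rintro _ ⟨x, hx, y, hy, rfl⟩ _ ⟨x', hx', y', hy', rfl⟩ z hz
        rw [hTF x hx y hy _ (hTA x' hx' y' hy' z hz), hTF x' hx' y' hy' _ (hTA x hx y hy z hz),
          hTF x hx y hy z hz, hTF x' hx' y' hy' z hz]
        have := hK' z hz _ (hFN x hx y) _ (hFN x' hx' y')
        rw [lie_lie] at this
        exact sub_eq_zero.mp this)
      (by rintro _ ⟨x, hx, y, hy, rfl⟩ z hz; exact hsq x hx y hy z hz)
    -- polarisation
    have hpol : ∀ z ∈ g (-2), (∀ x ∈ g 2, ∀ y ∈ g (-1), T x y z = 0) →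
        ∀ x ∈ g 2, ∀ y ∈ g (-1), ∀ y' ∈ g (-1), ⁅y, ⁅y', ⁅x, z⁆⁆⁆ = 0 := by
      intro z hz h x hx y hy y' hy'
      have h1 := h x hx y hy
      have h2 := h x hx y' hy'
      have h3 := h x hx (y + y') (add_mem hy hy')
      have h4 := habel _ (hAa _ (by simpa using hbr _ _ y hy y' hy')) _ (hw0 x hx z hz).2
      rw [T_apply] at h1 h2 h3
      simp only [add_lie, lie_add] at h3
      rw [lie_lie, sub_eq_zero] at h4
      rw [h1, h2, ← h4] at h3
      have h5 : (2:ℝ) • ⁅y, ⁅y', ⁅x, z⁆⁆⁆ = 0 := by rw [two_smul]; simpa using h3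
      simpa using h5
    let W : Submodule ℝ L :=
      { carrier := {z | z ∈ g (-2) ∧
          ∀ x ∈ g 2, ∀ y ∈ g (-1), ∀ y' ∈ g (-1), ⁅y, ⁅y', ⁅x, z⁆⁆⁆ = 0}
        zero_mem' := ⟨zero_mem _, by intros; simp⟩
        add_mem' := by
          rintro b c ⟨hb, hb'⟩ ⟨hc, hc'⟩
          refine ⟨add_mem hb hc, fun x hx y hy y' hy' => ?_⟩
          simp [hb' x hx y hy y' hy', hc' x hx y hy y' hy']
        smul_mem' := by
          rintro r b ⟨hb, hb'⟩
          refine ⟨Submodule.smul_mem _ r hb, fun x hx y hy y' hy' => ?_⟩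
          simp [hb' x hx y hy y' hy'] }
    have hWtop : W = g (-2) := by
      refine (hirr W (fun z hz => hz.1) ?_).resolve_left ?_
      · rintro e he z ⟨hz, hz'⟩
        refine ⟨by simpa using hbr _ _ e he z hz, fun x hx y hy y' hy' => ?_⟩
        have k1 := hz' ⁅x, e⁆ (by simpa using hbr _ _ x hx e he) y hy y' hy'
        have k2 := hz' x hx ⁅y, e⁆ (by simpa using hbr _ _ y hy e he) y' hy'
        have k3 := hz' x hx y hy ⁅y', e⁆ (by simpa using hbr _ _ y' hy' e he)
        have k4 := hz' x hx y hy y' hy'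
        rw [leibniz_lie x e z, lie_add, lie_add, k1, leibniz_lie y' e, lie_add, k3,
          leibniz_lie y e, k2, k4]
        simp
      · intro h
        have : v₁ ∈ W := ⟨hv₁, hpol v₁ hv₁ (fun x hx y hy => hv₁T _ ⟨x, hx, y, hy, rfl⟩)⟩
        rw [h] at this
        exact hv₁0 ((Submodule.mem_bot ℝ).mp this)
    apply h2ne
    rw [Submodule.eq_bot_iff]
    intro x hx
    refine hLem51 2 (by norm_num) x hx (fun z hz => ?_)
    have hzW : z ∈ W := hWtop ▸ hz
    obtain ⟨hw, -⟩ := hw0 x hx z hz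
    refine htrans 0 le_rfl _ hw (fun y' hy' => ?_)
    rw [← lie_skew, neg_eq_zero]
    refine hnondeg _ (by simpa using hbr _ _ y' hy' _ hw) (fun y hy => ?_)
    rw [← lie_skew, neg_eq_zero]
    exact hzW.2 x hx y hy y' hy'
  infer_instance
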